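/- For every vertex i, the least k ∈ ℕ such that X (k+1) i = X k i equals the in-eccentricity e(i), i.e. the maximum of dist(j,i) over all vertices j that reach i; equivalently, X (k+1) i = X k i holds if and only if k ≥ e(i). -/

import Mathlib

open scoped Classical

variable {V : Type*}

/-- Walks of length exactly `n`: `stepRel Adj n u v` means there is a directed walk
from `u` to `v` of length `n`. -/
def stepRel (Adj : V → V → Prop) : ℕ → V → V → Prop
  | 0 => Eq
  | (n+1) => fun u v => ∃ w, Adj u w ∧ stepRel Adj n w v

/-- `ddist Adj u v` is the minimum length of a directed walk from `u` to `v`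
(meaningful when `u` reaches `v`). -/
noncomputable def ddist (Adj : V → V → Prop) (u v : V) : ℕ :=
  sInf {n | stepRel Adj n u v}

/-- `reachSet Adj v` is the finite set of vertices that reach `v`. -/
noncomputable def reachSet [Fintype V] (Adj : V → V → Prop) (v : V) : Finset V :=
  Finset.univ.filter (fun u => Relation.ReflTransGen Adj u v)

/-- In-eccentricity: the maximum of `ddist Adj j i` over all `j` reaching `i`. -/
noncomputable def ecc [Fintype V] (Adj : V → V → Prop) (i : V) : ℕ :=
  (Finset.univ.filter (fun j => Relation.ReflTransGen Adj j i)).sup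
    (fun j => ddist Adj j i)

/-- Finite digraph diameter: maximum of `ddist Adj u v` over ordered pairs `(u, v)`
with `u` reaching `v`. -/
noncomputable def fdiam [Fintype V] (Adj : V → V → Prop) : ℕ :=
  (Finset.univ.filter (fun p : V × V => Relation.ReflTransGen Adj p.1 p.2)).sup
    (fun p => ddist Adj p.1 p.2)

/-- Algorithm 1's flooding iteration: `flood Adj 0 i = {i}` and
`flood Adj (k+1) i = flood Adj k i ∪ ⋃_{j with Adj j i} flood Adj k j`. -/
noncomputable def flood [Fintype V] [DecidableEq V] (Adj : V → V → Prop) : ℕ → V → Finset V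
  | 0, i => {i}
  | (k+1), i => flood Adj k i ∪
      (Finset.univ.filter (fun j => Adj j i)).biUnion (fun j => flood Adj k j)

theorem stepRel_add (Adj : V → V → Prop) (m n : ℕ) (u v : V) :
    stepRel Adj (m + n) u v ↔ ∃ w, stepRel Adj m u w ∧ stepRel Adj n w v := by
  induction m generalizing u with
  | zero => simp [stepRel]
  | succ m ih =>
    rw [Nat.add_right_comm]
    simp only [stepRel, ih]
    tauto

theorem stepRel_one (Adj : V → V → Prop) (u v : V) : stepRel Adj 1 u v ↔ Adj u v := by
  simp [stepRel]

theorem reflTransGen_iff_exists_stepRel (Adj : V → V → Prop) (u v : V) :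
    Relation.ReflTransGen Adj u v ↔ ∃ n, stepRel Adj n u v := by
  constructor
  · intro h
    induction h using Relation.ReflTransGen.head_induction_on with
    | refl => exact ⟨0, rfl⟩
    | head h _ ih =>
      obtain ⟨n, hn⟩ := ih
      exact ⟨n + 1, _, h, hn⟩
  · rintro ⟨n, hn⟩
    induction n generalizing u with
    | zero => exact hn ▸ .refl
    | succ n ih =>
      obtain ⟨w, hw, hn⟩ := hn
      exact .head hw (ih w hn)

theorem stepRel_ddist {Adj : V → V → Prop} {u v : V} (h : Relation.ReflTransGen Adj u v) :
    stepRel Adj (ddist Adj u v) u v :=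
  Nat.sInf_mem (s := {n | stepRel Adj n u v}) ((reflTransGen_iff_exists_stepRel Adj u v).1 h)

theorem ddist_le {Adj : V → V → Prop} {n : ℕ} {u v : V} (h : stepRel Adj n u v) :
    ddist Adj u v ≤ n :=
  Nat.sInf_le h

theorem mem_flood [Fintype V] [DecidableEq V] (Adj : V → V → Prop) (k : ℕ) (i j : V) :
    j ∈ flood Adj k i ↔ ∃ n ≤ k, stepRel Adj n j i := by
  induction k generalizing i with
  | zero => simp [flood, stepRel]
  | succ k ih =>
    simp only [flood, Finset.mem_union, Finset.mem_biUnion, Finset.mem_filter, Finset.mem_univ,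
      true_and, ih]
    constructor
    · rintro (⟨n, hn, h⟩ | ⟨w, hw, n, hn, h⟩)
      · exact ⟨n, by lia, h⟩
      · exact ⟨n + 1, by lia, (stepRel_add Adj n 1 j i).2 ⟨w, h, (stepRel_one Adj w i).2 hw⟩⟩
    · rintro ⟨_ | n, hn, h⟩
      · exact .inl ⟨0, by lia, h⟩
      · obtain ⟨w, h, hw⟩ := (stepRel_add Adj n 1 j i).1 h
        exact .inr ⟨w, (stepRel_one Adj w i).1 hw, n, by lia, h⟩

theorem flood_succ_eq_iff [Fintype V] [DecidableEq V] (Adj : V → V → Prop) (k : ℕ) (i : V) :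
    flood Adj (k + 1) i = flood Adj k i ↔ ecc Adj i ≤ k := by
  simp only [ecc, Finset.sup_le_iff, Finset.mem_filter, Finset.mem_univ, true_and]
  constructor
  · intro h j hj
    by_contra! hk
    obtain ⟨m, hm⟩ := Nat.exists_eq_add_of_le' (Nat.succ_le_of_lt hk)
    have hd := stepRel_ddist hj
    rw [hm, stepRel_add] at hd
    obtain ⟨w, hjw, hwi⟩ := hd
    have hw : w ∈ flood Adj (k + 1) i := (mem_flood Adj (k + 1) i w).2 ⟨k + 1, le_rfl, hwi⟩
    rw [h, mem_flood] at hw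
    obtain ⟨n, hn, hwi⟩ := hw
    have := ddist_le ((stepRel_add Adj m n j i).2 ⟨w, hjw, hwi⟩)
    lia
  · intro h
    ext j
    simp only [mem_flood]
    constructor
    · rintro ⟨n, -, hn⟩
      have hj := (reflTransGen_iff_exists_stepRel Adj j i).2 ⟨n, hn⟩
      exact ⟨_, h j hj, stepRel_ddist hj⟩
    · rintro ⟨n, hk, hn⟩
      exact ⟨n, by lia, hn⟩

/-- the least `k` with `X (k+1) i = X k i` equals the in-eccentricity
`e(i)`; equivalently `X (k+1) i = X k i ↔ k ≥ e(i)`. -/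
theorem stmt5 [Fintype V] [DecidableEq V] (Adj : V → V → Prop) (i : V) :
    sInf {k : ℕ | flood Adj (k+1) i = flood Adj k i} = ecc Adj i ∧
    (∀ k : ℕ, flood Adj (k+1) i = flood Adj k i ↔ k ≥ ecc Adj i) := by
  refine ⟨?_, fun k => flood_succ_eq_iff Adj k i⟩
  simp only [flood_succ_eq_iff]
  exact csInf_Ici
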